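/- arXiv:1111.3210 — 8 statements merged into one kernel-verified Lean document; each statement's English description precedes it below -/
import Mathlib

section
/- For every σ² = (σ_e², σ_{u₁}², …, σ_{u_r}²) ∈ (0,∞)^{r+1}, the trace bound tr((I − P_X) Z Q⁻¹ Zᵀ (I − P_X)) ≤ rank(Zᵀ(I − P_X)Z) · σ_e² holds. -/
open Matrix

/-- If `T² ≤ c T` in the Loewner order, then the nonzero eigenvalues of `T` are at most `c`, so
that `tr T ≤ c · rank T`. -/
theorem Matrix.IsHermitian.trace_le_rank_mul {n : Type*} [Fintype n] [DecidableEq n]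
    {T : Matrix n n ℝ} (hT : T.IsHermitian) {c : ℝ} (hc : 0 ≤ c)
    (h : (c • T - T * T).PosSemidef) :
    T.trace ≤ (T.rank : ℝ) * c := by
  have key : ∀ i, hT.eigenvalues i * hT.eigenvalues i ≤ c * hT.eigenvalues i := by
    intro i
    set v : n → ℝ := ⇑(hT.eigenvectorBasis i)
    have hTv : T *ᵥ v = hT.eigenvalues i • v := hT.mulVec_eigenvectorBasis i
    have hv0 : v ≠ 0 := fun h0 =>
      hT.eigenvectorBasis.orthonormal.ne_zero i (by ext j; exact congrFun h0 j)
    have hpos : 0 < star v ⬝ᵥ v := dotProduct_star_self_pos_iff.mpr hv0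
    have hnn := h.dotProduct_mulVec_nonneg v
    rw [sub_mulVec, smul_mulVec, ← mulVec_mulVec, hTv, mulVec_smul, hTv, smul_smul, smul_smul,
      ← sub_smul, dotProduct_smul, smul_eq_mul] at hnn
    linarith [nonneg_of_mul_nonneg_left hnn hpos]
  have htr : T.trace = ∑ i, hT.eigenvalues i := by
    simpa using hT.trace_eq_sum_eigenvalues
  rw [htr, hT.rank_eq_card_non_zero_eigs, Fintype.card_subtype, ← nsmul_eq_mul,
    ← Finset.sum_filter_ne_zero]
  refine Finset.sum_le_card_nsmul _ _ _ fun i hi => ?_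
  have hne : hT.eigenvalues i ≠ 0 := (Finset.mem_filter.mp hi).2
  have hnn : 0 ≤ hT.eigenvalues i := by
    by_contra! hneg
    nlinarith [key i, mul_pos_of_neg_of_neg hneg hneg]
  exact le_of_mul_le_mul_right (key i) (hnn.lt_of_ne' hne)

/-- Trace bound for `W Q⁻¹ Wᵀ` with `Q = c⁻¹ Wᵀ W + E`. -/
theorem Matrix.trace_mul_inv_mul_transpose_le {m n : Type*} [Fintype m] [DecidableEq m]
    [Fintype n] [DecidableEq n] (W : Matrix m n ℝ) {E : Matrix n n ℝ} (hE : E.PosDef)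
    {c : ℝ} (hc : 0 < c) :
    (W * (c⁻¹ • (Wᵀ * W) + E)⁻¹ * Wᵀ).trace ≤ ((Wᵀ * W).rank : ℝ) * c := by
  set Q := c⁻¹ • (Wᵀ * W) + E with hQ
  have hW : (Wᵀ * W).PosSemidef := by
    simpa using posSemidef_conjTranspose_mul_self W
  have hQpd : Q.PosDef := PosDef.posSemidef_add (hW.smul (inv_nonneg.mpr hc.le)) hE
  have hdet : IsUnit Q.det := (isUnit_iff_isUnit_det Q).mp hQpd.isUnit
  have hQinv : Q⁻¹.PosSemidef := hQpd.inv.posSemidef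
  have hQt : (Q⁻¹)ᵀ = Q⁻¹ := by simpa using hQinv.isHermitian.eq
  have hT : (W * Q⁻¹ * Wᵀ).PosSemidef := by
    simpa using hQinv.mul_mul_conjTranspose_same W
  have hWW : Wᵀ * W = c • (Q - E) := by
    rw [hQ, add_sub_cancel_right, smul_inv_smul₀ hc.ne']
  have hdiff : c • (W * Q⁻¹ * Wᵀ) - W * Q⁻¹ * Wᵀ * (W * Q⁻¹ * Wᵀ)
      = c • (W * Q⁻¹ * E * (W * Q⁻¹)ᵀ) := by
    have hsq : W * Q⁻¹ * Wᵀ * (W * Q⁻¹ * Wᵀ) = W * Q⁻¹ * (Wᵀ * W) * (Q⁻¹ * Wᵀ) := by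
      simp only [Matrix.mul_assoc]
    rw [hsq, hWW, transpose_mul, hQt, Matrix.mul_smul, Matrix.smul_mul, ← smul_sub,
      Matrix.mul_sub, Matrix.sub_mul, nonsing_inv_mul_cancel_right _ _ hdet,
      ← Matrix.mul_assoc W, sub_sub_cancel]
  have hrank : (W * Q⁻¹ * Wᵀ).rank ≤ (Wᵀ * W).rank := by
    rw [rank_transpose_mul_self, Matrix.mul_assoc]
    exact rank_mul_le_left _ _
  refine (hT.isHermitian.trace_le_rank_mul hc.le ?_).trans (by gcongr)
  rw [hdiff]
  simpa using (hE.posSemidef.mul_mul_conjTranspose_same (W * Q⁻¹)).smul hc.le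

/-- For the GLMM with `P_X = X(XᵀX)⁻¹Xᵀ`, `D = ⊕ᵢ σ_{uᵢ}² I_{qᵢ}` and
`Q = (σ_e²)⁻¹ Zᵀ(I−P_X)Z + D⁻¹`, the trace bound
`tr((I−P_X) Z Q⁻¹ Zᵀ (I−P_X)) ≤ rank(Zᵀ(I−P_X)Z) · σ_e²` holds for all positive `σ²`.
Here `σe` plays the role of `σ_e²` and `σu i` that of `σ_{uᵢ}²`. -/
theorem trace_bound_glmm
    (N p r : ℕ) (hN : 1 ≤ N) (hp : 1 ≤ p) (hr : 1 ≤ r)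
    (qi : Fin r → ℕ) (hqi : ∀ i, 1 ≤ qi i)
    (X : Matrix (Fin N) (Fin p) ℝ) (hX : X.rank = p)
    (Z : Matrix (Fin N) ((i : Fin r) × Fin (qi i)) ℝ)
    (PX : Matrix (Fin N) (Fin N) ℝ) (hPX : PX = X * (Xᵀ * X)⁻¹ * Xᵀ)
    (σe : ℝ) (hσe : 0 < σe) (σu : Fin r → ℝ) (hσu : ∀ i, 0 < σu i)
    (Q : Matrix ((i : Fin r) × Fin (qi i)) ((i : Fin r) × Fin (qi i)) ℝ)
    (hQ : Q = σe⁻¹ • (Zᵀ * (1 - PX) * Z) + Matrix.diagonal (fun k => (σu k.1)⁻¹)) :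
    ((1 - PX) * Z * Q⁻¹ * Zᵀ * (1 - PX)).trace
      ≤ ((Zᵀ * (1 - PX) * Z).rank : ℝ) * σe := by
  have hPt : PXᵀ = PX := by
    rw [hPX]
    simp [transpose_nonsing_inv, Matrix.mul_assoc]
  have hdet : IsUnit (Xᵀ * X).det := by
    rw [← isUnit_iff_isUnit_det, ← linearIndependent_cols_iff_isUnit,
      linearIndependent_iff_card_eq_finrank_span, Set.finrank, ← rank_eq_finrank_span_cols,
      rank_transpose_mul_self, hX, Fintype.card_fin]
  have hPP : PX * PX = PX := by
    rw [hPX]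
    simp only [Matrix.mul_assoc]
    rw [← Matrix.mul_assoc Xᵀ X, mul_nonsing_inv_cancel_left _ _ hdet]
  have hMt : (1 - PX)ᵀ = 1 - PX := by rw [transpose_sub, transpose_one, hPt]
  have hMM : (1 - PX) * (1 - PX) = 1 - PX := IsIdempotentElem.one_sub hPP
  have hWt : ((1 - PX) * Z)ᵀ = Zᵀ * (1 - PX) := by rw [transpose_mul, hMt]
  have hWW : ((1 - PX) * Z)ᵀ * ((1 - PX) * Z) = Zᵀ * (1 - PX) * Z := by
    rw [hWt, Matrix.mul_assoc, ← Matrix.mul_assoc _ _ Z, hMM, Matrix.mul_assoc]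
  have hE : (diagonal fun k : (i : Fin r) × Fin (qi i) => (σu k.1)⁻¹).PosDef :=
    PosDef.diagonal fun k => inv_pos.mpr (hσu k.1)
  have h := trace_mul_inv_mul_transpose_le ((1 - PX) * Z) hE hσe
  rwa [hWW, ← hQ, hWt, ← Matrix.mul_assoc] at h
end

section
/- For every σ² = (σ_e², σ_{u₁}², …, σ_{u_r}²) ∈ (0,∞)^{r+1} and every i ∈ {1,…,r}, the matrix ((σ_e²)⁻¹ λ_max + (σ_{u_i}²)⁻¹) I_{q_i} − (R_i Q⁻¹ R_iᵀ)⁻¹ is positive semidefinite, where λ_max is the largest eigenvalue of Zᵀ(I−P_X)Z. (Here R_i Q⁻¹ R_iᵀ is symmetric positive definite, hence invertible.) -/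
open Matrix

/-- A Hermitian real matrix is bounded above, in the Loewner order, by any upper bound of its
eigenvalues. -/
theorem Matrix.IsHermitian.posSemidef_smul_one_sub {n : Type*} [Fintype n] [DecidableEq n]
    {A : Matrix n n ℝ} (hA : A.IsHermitian) {c : ℝ} (hc : ∀ k, hA.eigenvalues k ≤ c) :
    (c • (1 : Matrix n n ℝ) - A).PosSemidef := by
  have key : c • (1 : Matrix n n ℝ) - A = (hA.eigenvectorUnitary : Matrix n n ℝ) *
      diagonal (fun k => c - hA.eigenvalues k) * (hA.eigenvectorUnitary : Matrix n n ℝ)ᴴ := by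
    have hU : (hA.eigenvectorUnitary : Matrix n n ℝ) * (hA.eigenvectorUnitary : Matrix n n ℝ)ᴴ = 1 :=
      Unitary.coe_mul_star_self hA.eigenvectorUnitary
    have hD : diagonal (fun k => c - hA.eigenvalues k) =
        c • (1 : Matrix n n ℝ) - diagonal hA.eigenvalues := by
      rw [smul_one_eq_diagonal, diagonal_sub]
    have hs : A = (hA.eigenvectorUnitary : Matrix n n ℝ) * diagonal hA.eigenvalues *
        (hA.eigenvectorUnitary : Matrix n n ℝ)ᴴ := hA.spectral_theorem
    rw [hD, Matrix.mul_sub, Matrix.sub_mul, ← hs, Matrix.mul_smul, Matrix.smul_mul, Matrix.mul_one,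
      hU]
  rw [key]
  exact (PosSemidef.diagonal fun k => sub_nonneg.2 (hc k)).mul_mul_conjTranspose_same _

/-- If `R Rᵀ = 1`, the compression of a positive definite matrix by `R` dominates the inverse of
the compression of its inverse. -/
theorem Matrix.PosDef.posSemidef_compression_sub_inv {m n : Type*} [Fintype m] [DecidableEq m]
    [Fintype n] [DecidableEq n] {Q : Matrix n n ℝ} (hQ : Q.PosDef) {R : Matrix m n ℝ}
    (hR : R * Rᵀ = 1) :
    (R * Q * Rᵀ - (R * Q⁻¹ * Rᵀ)⁻¹).PosSemidef := by
  set S := R * Q⁻¹ * Rᵀ with hS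
  have hinj : Function.Injective R.vecMul := fun x y h => by
    simpa [vecMul_vecMul, hR] using congrArg (fun v => v ᵥ* Rᵀ) h
  have hSpos : S.PosDef := by
    simpa [hS, conjTranspose_eq_transpose_of_trivial] using hQ.inv.mul_mul_conjTranspose_same hinj
  have hST : (S⁻¹)ᵀ = S⁻¹ := by
    simpa [conjTranspose_eq_transpose_of_trivial] using hSpos.inv.isHermitian.eq
  have hQT : (Q⁻¹)ᵀ = Q⁻¹ := by
    simpa [conjTranspose_eq_transpose_of_trivial] using hQ.inv.isHermitian.eq
  have hQQ : Q⁻¹ * Q = 1 := nonsing_inv_mul Q ((isUnit_iff_isUnit_det Q).1 hQ.isUnit)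
  have hQQ' : Q * Q⁻¹ = 1 := mul_nonsing_inv Q ((isUnit_iff_isUnit_det Q).1 hQ.isUnit)
  have hSS : S * S⁻¹ = 1 := mul_nonsing_inv S ((isUnit_iff_isUnit_det S).1 hSpos.isUnit)
  have key : R * Q * Rᵀ - S⁻¹ =
      (R - S⁻¹ * R * Q⁻¹) * Q * (R - S⁻¹ * R * Q⁻¹)ᴴ := by
    have h₁ : (R - S⁻¹ * R * Q⁻¹) * Q = R * Q - S⁻¹ * R := by
      rw [Matrix.sub_mul, Matrix.mul_assoc _ Q⁻¹ Q, hQQ, Matrix.mul_one]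
    have h₂ : (R - S⁻¹ * R * Q⁻¹)ᴴ = Rᵀ - Q⁻¹ * Rᵀ * S⁻¹ := by
      rw [conjTranspose_eq_transpose_of_trivial, transpose_sub, transpose_mul, transpose_mul, hQT,
        hST, Matrix.mul_assoc]
    have h₃ : R * Q * (Q⁻¹ * Rᵀ * S⁻¹) = S⁻¹ := by
      calc R * Q * (Q⁻¹ * Rᵀ * S⁻¹) = R * (Q * Q⁻¹) * Rᵀ * S⁻¹ := by simp only [Matrix.mul_assoc]
        _ = S⁻¹ := by rw [hQQ', Matrix.mul_one, hR, Matrix.one_mul]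
    have h₄ : S⁻¹ * R * Rᵀ = S⁻¹ := by rw [Matrix.mul_assoc, hR, Matrix.mul_one]
    have h₅ : S⁻¹ * R * (Q⁻¹ * Rᵀ * S⁻¹) = S⁻¹ := by
      calc S⁻¹ * R * (Q⁻¹ * Rᵀ * S⁻¹) = S⁻¹ * (S * S⁻¹) := by simp only [hS, Matrix.mul_assoc]
        _ = S⁻¹ := by rw [hSS, Matrix.mul_one]
    rw [h₁, h₂, Matrix.sub_mul, Matrix.mul_sub, Matrix.mul_sub, h₃, h₄, h₅]
    abel
  rw [key]
  exact hQ.posSemidef.mul_mul_conjTranspose_same _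

/-- The complement of the projection `X (XᵀX)⁻¹ Xᵀ` is positive semidefinite. No rank condition is
needed: if `XᵀX` is singular then its `Matrix` inverse is `0`. -/
theorem Matrix.posSemidef_one_sub_proj {m n : Type*} [Fintype m] [DecidableEq m]
    [Fintype n] [DecidableEq n] (X : Matrix m n ℝ) :
    (1 - X * (Xᵀ * X)⁻¹ * Xᵀ).PosSemidef := by
  set A := (Xᵀ * X)⁻¹ with hA
  have hAT : Aᵀ = A := by
    rw [hA, transpose_nonsing_inv, transpose_mul, transpose_transpose]
  have hAG : A * (Xᵀ * X) * A = A := by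
    by_cases h : IsUnit (Xᵀ * X).det
    · rw [hA, nonsing_inv_mul _ h, Matrix.one_mul]
    · simp [hA, nonsing_inv_apply_not_isUnit _ h]
  have hT : (X * A * Xᵀ)ᵀ = X * A * Xᵀ := by
    rw [transpose_mul, transpose_mul, transpose_transpose, hAT, Matrix.mul_assoc]
  have hI : X * A * Xᵀ * (X * A * Xᵀ) = X * A * Xᵀ := by
    calc X * A * Xᵀ * (X * A * Xᵀ) = X * (A * (Xᵀ * X) * A) * Xᵀ := by
          simp only [Matrix.mul_assoc]
      _ = X * A * Xᵀ := by rw [hAG]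
  have key : 1 - X * A * Xᵀ = (1 - X * A * Xᵀ)ᴴ * (1 - X * A * Xᵀ) := by
    rw [conjTranspose_eq_transpose_of_trivial, transpose_sub, transpose_one, hT, Matrix.sub_mul,
      Matrix.one_mul, Matrix.mul_sub, Matrix.mul_one, hI, sub_self, sub_zero]
  rw [key]
  exact posSemidef_conjTranspose_mul_self _

/-- For the GLMM with `Q = (σ_e²)⁻¹ Zᵀ(I−P_X)Z + D⁻¹`, `λ_max` the largest eigenvalue of
`Zᵀ(I−P_X)Z`, and `Rᵢ` the extraction matrix of the `i`-th block, the matrix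
`((σ_e²)⁻¹ λ_max + (σ_{uᵢ}²)⁻¹) I_{qᵢ} − (Rᵢ Q⁻¹ Rᵢᵀ)⁻¹` is positive semidefinite.
Here `σe` plays the role of `σ_e²` and `σu i` that of `σ_{uᵢ}²`. -/
theorem lambda_max_bound_glmm
    (N p r : ℕ) (hN : 1 ≤ N) (hp : 1 ≤ p) (hr : 1 ≤ r)
    (qi : Fin r → ℕ) (hqi : ∀ i, 1 ≤ qi i)
    (X : Matrix (Fin N) (Fin p) ℝ) (hX : X.rank = p)
    (Z : Matrix (Fin N) ((i : Fin r) × Fin (qi i)) ℝ)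
    (PX : Matrix (Fin N) (Fin N) ℝ) (hPX : PX = X * (Xᵀ * X)⁻¹ * Xᵀ)
    (σe : ℝ) (hσe : 0 < σe) (σu : Fin r → ℝ) (hσu : ∀ i, 0 < σu i)
    (Q : Matrix ((i : Fin r) × Fin (qi i)) ((i : Fin r) × Fin (qi i)) ℝ)
    (hQ : Q = σe⁻¹ • (Zᵀ * (1 - PX) * Z) + Matrix.diagonal (fun k => (σu k.1)⁻¹))
    (hM : (Zᵀ * (1 - PX) * Z).IsHermitian)
    (lam : ℝ) (hlam : lam = ⨆ k, hM.eigenvalues k)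
    (i : Fin r)
    (Ri : Matrix (Fin (qi i)) ((j : Fin r) × Fin (qi j)) ℝ)
    (hRi : ∀ j k, Ri j k = if k = ⟨i, j⟩ then 1 else 0) :
    ((σe⁻¹ * lam + (σu i)⁻¹) • (1 : Matrix (Fin (qi i)) (Fin (qi i)) ℝ)
      - (Ri * Q⁻¹ * Riᵀ)⁻¹).PosSemidef := by
  have hMpsd : (Zᵀ * (1 - PX) * Z).PosSemidef := by
    simpa [hPX, conjTranspose_eq_transpose_of_trivial] using
      (posSemidef_one_sub_proj X).conjTranspose_mul_mul_same Z
  have hQpos : Q.PosDef := by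
    rw [hQ]
    exact (PosDef.diagonal fun k : (j : Fin r) × Fin (qi j) => inv_pos.2 (hσu k.1)).posSemidef_add
      (hMpsd.smul (inv_nonneg.2 hσe.le))
  have hRR : Ri * Riᵀ = 1 := by
    ext a b
    simp [mul_apply, hRi, one_apply, eq_comm]
  have hRD : Ri * diagonal (fun k : (j : Fin r) × Fin (qi j) => (σu k.1)⁻¹) = (σu i)⁻¹ • Ri := by
    ext a k
    by_cases h : k = ⟨i, a⟩
    · subst h
      simp [hRi]
    · simp [hRi, h]
  have hbound : (lam • (1 : Matrix _ _ ℝ) - Zᵀ * (1 - PX) * Z).PosSemidef :=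
    hM.posSemidef_smul_one_sub fun k => hlam ▸ le_ciSup (Set.finite_range _).bddAbove k
  have hcomp := (hbound.mul_mul_conjTranspose_same Ri).smul (inv_nonneg.2 hσe.le)
  rw [conjTranspose_eq_transpose_of_trivial] at hcomp
  convert hcomp.add (hQpos.posSemidef_compression_sub_inv hRR) using 1
  have hRQR : Ri * Q * Riᵀ =
      σe⁻¹ • (Ri * (Zᵀ * (1 - PX) * Z) * Riᵀ) + (σu i)⁻¹ • (1 : Matrix _ _ ℝ) := by
    rw [hQ, Matrix.mul_add, Matrix.add_mul, hRD, Matrix.mul_smul, Matrix.smul_mul,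
      Matrix.smul_mul, hRR]
  rw [hRQR, Matrix.mul_sub, Matrix.sub_mul, Matrix.mul_smul, Matrix.smul_mul, Matrix.mul_one, hRR,
    smul_sub, smul_smul, add_smul]
  abel
end

section
/- Fix integers n ≥ 2 and m ≥ 1, and vectors x₁, x₂, …, x_n ∈ ℝ^m. For w = (w₁,…,w_n) ∈ (0,∞)^n, the m×m matrix M(w) = x₁x₁ᵀ + Σ_{i=2}^n w_i x_i x_iᵀ + w₁ I_m is symmetric positive definite (hence invertible), and the set { x₁ᵀ M(w)⁻² x₁ : w ∈ (0,∞)^n } is bounded above; that is, sup_{w ∈ (0,∞)^n} x₁ᵀ M(w)⁻² x₁ < ∞. -/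
open Matrix

open Filter Topology in
/-- The points `z` whose residuals `b - A z` have a prescribed sign pattern and which solve some
positively weighted least squares problem for `(A, b)` form a bounded set, provided that `A` is
injective. -/
theorem isBounded_weightedLeastSquares_of_sign {ι : Type*} [Fintype ι] {m : ℕ}
    (A : ι → Fin m → ℝ) (b : ι → ℝ) (hA : ∀ u, (∀ i, A i ⬝ᵥ u = 0) → u = 0)
    (s : ι → SignType) :
    Bornology.IsBounded {z : Fin m → ℝ | (∀ i, SignType.sign (b i - A i ⬝ᵥ z) = s i) ∧
      ∃ d : ι → ℝ, (∀ i, 0 < d i) ∧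
        ∀ u, ∑ i, d i * ((A i ⬝ᵥ u) * (b i - A i ⬝ᵥ z)) = 0} := by
  by_contra hb
  rw [isBounded_iff_forall_norm_le] at hb
  push Not at hb
  choose z hz hzn using fun k : ℕ => hb (k + 1)
  have hpos : ∀ k, 0 < ‖z k‖ := fun k => lt_trans (by positivity) (hzn k)
  obtain ⟨u, hu, φ, hφ, hlim⟩ := (isCompact_sphere (0 : Fin m → ℝ) 1).tendsto_subseq
    (x := fun k => ‖z k‖⁻¹ • z k) (fun k => by
      simp [norm_smul, (hpos k).ne'])
  have hnorm : Tendsto (fun k => ‖z (φ k)‖) atTop atTop :=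
    (tendsto_atTop_mono (fun k : ℕ => ((lt_add_one (k : ℝ)).trans (hzn k)).le)
      tendsto_natCast_atTop_atTop).comp hφ.tendsto_atTop
  have hres : ∀ i, Tendsto (fun k => ‖z (φ k)‖⁻¹ * (b i - A i ⬝ᵥ z (φ k))) atTop
      (𝓝 (-(A i ⬝ᵥ u))) := by
    intro i
    have hdot : Continuous fun v : Fin m → ℝ => A i ⬝ᵥ v := by fun_prop
    have h := ((tendsto_inv_atTop_zero.comp hnorm).mul_const (b i)).sub
      ((hdot.tendsto u).comp hlim)
    simpa [Function.comp_def, mul_sub, dotProduct_smul] using h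
  have hsign : ∀ i, (s i : ℝ) * (A i ⬝ᵥ u) ≤ 0 := by
    intro i
    have h := ge_of_tendsto' ((hres i).const_mul (s i : ℝ)) (b := 0) (fun k => by
      rw [← (hz (φ k)).1 i, mul_left_comm, sign_mul_self]
      positivity)
    linarith
  have hzero : ∀ i, s i = 0 → A i ⬝ᵥ u = 0 := by
    intro i hi
    have h := hres i
    have hr : ∀ k, b i - A i ⬝ᵥ z (φ k) = 0 := fun k =>
      sign_eq_zero_iff.1 (((hz (φ k)).1 i).trans hi)
    simp only [hr, mul_zero] at h
    linarith [tendsto_nhds_unique h tendsto_const_nhds]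
  obtain ⟨hs, d, hd, hsum⟩ := hz 0
  have hterm : ∀ i ∈ Finset.univ, d i * ((A i ⬝ᵥ u) * (b i - A i ⬝ᵥ z 0)) ≤ 0 := by
    intro i _
    refine mul_nonpos_of_nonneg_of_nonpos (hd i).le ?_
    rw [← sign_mul_abs (b i - A i ⬝ᵥ z 0), hs i, ← mul_assoc, mul_comm (A i ⬝ᵥ u)]
    exact mul_nonpos_of_nonpos_of_nonneg (hsign i) (abs_nonneg _)
  have hAu : ∀ i, A i ⬝ᵥ u = 0 := by
    intro i
    have h := (Finset.sum_eq_zero_iff_of_nonpos hterm).1 (hsum u) i (Finset.mem_univ i)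
    rcases mul_eq_zero.1 ((mul_eq_zero.1 h).resolve_left (hd i).ne') with h | h
    · exact h
    · exact hzero i (by rw [← hs i, h, sign_zero])
  simp [hA u hAu] at hu

/-- Solutions of positively weighted least squares problems are bounded uniformly in the
weights. -/
theorem isBounded_weightedLeastSquares {ι : Type*} [Fintype ι] {m : ℕ}
    (A : ι → Fin m → ℝ) (b : ι → ℝ) (hA : ∀ u, (∀ i, A i ⬝ᵥ u = 0) → u = 0) :
    Bornology.IsBounded {z : Fin m → ℝ | ∃ d : ι → ℝ, (∀ i, 0 < d i) ∧
        ∀ u, ∑ i, d i * ((A i ⬝ᵥ u) * (b i - A i ⬝ᵥ z)) = 0} := by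
  refine (Bornology.isBounded_iUnion.2
    (isBounded_weightedLeastSquares_of_sign A b hA)).subset ?_
  intro z hz
  exact Set.mem_iUnion.2 ⟨fun i => SignType.sign (b i - A i ⬝ᵥ z), fun _ => rfl, hz⟩

/-- For fixed vectors `x₁,…,x_n` in `ℝ^m` (indexed here by `x 0, …, x (n-1)`), the matrix
`M(w) = x₁x₁ᵀ + Σ_{i=2}^n wᵢ xᵢxᵢᵀ + w₁ I_m` is positive definite for every
`w ∈ (0,∞)^n`, and `sup_{w ∈ (0,∞)^n} x₁ᵀ M(w)⁻² x₁ < ∞`. -/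
theorem sup_quadratic_form_finite (n m : ℕ) [NeZero n] (hn : 2 ≤ n) (hm : 1 ≤ m)
    (x : Fin n → Fin m → ℝ)
    (M : (Fin n → ℝ) → Matrix (Fin m) (Fin m) ℝ)
    (hM : ∀ w, M w = vecMulVec (x 0) (x 0)
        + ∑ i ∈ Finset.univ.erase (0 : Fin n), w i • vecMulVec (x i) (x i) + w 0 • 1) :
    (∀ w : Fin n → ℝ, (∀ i, 0 < w i) → (M w).PosDef) ∧
    BddAbove {t : ℝ | ∃ w : Fin n → ℝ, (∀ i, 0 < w i) ∧
        t = x 0 ⬝ᵥ (((M w)⁻¹ * (M w)⁻¹) *ᵥ x 0)} := by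
  have hform : ∀ w u v, u ⬝ᵥ (M w *ᵥ v) = (x 0 ⬝ᵥ u) * (x 0 ⬝ᵥ v)
      + ∑ i ∈ Finset.univ.erase (0 : Fin n), w i * ((x i ⬝ᵥ u) * (x i ⬝ᵥ v))
      + w 0 * (u ⬝ᵥ v) := by
    intro w u v
    simp only [hM, add_mulVec, sum_mulVec, smul_mulVec, one_mulVec, dotProduct_add,
      dotProduct_sum, dotProduct_smul, vecMulVec_mulVec, smul_eq_mul, op_smul_eq_smul,
      dotProduct_comm u (x _)]
    congr 2
    · ring
    · exact Finset.sum_congr rfl fun i _ => by ring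
  have hsymm : ∀ w, (M w)ᵀ = M w := by
    intro w
    simp [hM, transpose_sum, transpose_vecMulVec]
  have hpd : ∀ w : Fin n → ℝ, (∀ i, 0 < w i) → (M w).PosDef := by
    intro w hw
    refine PosDef.of_dotProduct_mulVec_pos ?_ fun u hu => ?_
    · simpa [IsHermitian, conjTranspose_eq_transpose_of_trivial] using hsymm w
    · have huu : 0 < u ⬝ᵥ u := by simpa using dotProduct_star_self_pos_iff.2 hu
      rw [star_trivial, hform]
      have hsum : 0 ≤ ∑ i ∈ Finset.univ.erase (0 : Fin n), w i * ((x i ⬝ᵥ u) * (x i ⬝ᵥ u)) :=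
        Finset.sum_nonneg fun i _ => mul_nonneg (hw i).le (mul_self_nonneg _)
      have := mul_pos (hw 0) huu
      have := mul_self_nonneg (x 0 ⬝ᵥ u)
      linarith
  refine ⟨hpd, ?_⟩
  let A : Fin n ⊕ Fin m → Fin m → ℝ := Sum.elim x fun j => Pi.single j 1
  let b : Fin n ⊕ Fin m → ℝ := Pi.single (Sum.inl 0) 1
  have hA : ∀ u, (∀ i, A i ⬝ᵥ u = 0) → u = 0 := fun u hu => by
    ext j
    simpa [A] using hu (Sum.inr j)
  obtain ⟨C, hC⟩ := isBounded_iff_forall_norm_le.1 (isBounded_weightedLeastSquares A b hA)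
  refine ⟨∑ _j : Fin m, C * C, ?_⟩
  rintro t ⟨w, hw, rfl⟩
  set z := (M w)⁻¹ *ᵥ x 0 with hz
  have hMz : M w *ᵥ z = x 0 := by
    rw [hz, mulVec_mulVec, mul_nonsing_inv _ ((isUnit_iff_isUnit_det _).1 (hpd w hw).isUnit),
      one_mulVec]
  have hzC : ‖z‖ ≤ C := by
    refine hC z ⟨Sum.elim (Function.update w 0 1) fun _ => w 0, ?_, fun u => ?_⟩
    · rintro (i | j)
      · rcases eq_or_ne i 0 with rfl | hi
        · simp
        · simpa [hi] using hw i
      · exact hw 0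
    · have h := hform w u z
      rw [hMz, dotProduct_comm] at h
      have hrest : ∑ i ∈ Finset.univ.erase (0 : Fin n),
          Function.update w 0 1 i * ((x i ⬝ᵥ u) * (b (Sum.inl i) - x i ⬝ᵥ z)) =
          -∑ i ∈ Finset.univ.erase (0 : Fin n), w i * ((x i ⬝ᵥ u) * (x i ⬝ᵥ z)) := by
        rw [← Finset.sum_neg_distrib]
        refine Finset.sum_congr rfl fun i hi => ?_
        simp [b, Finset.ne_of_mem_erase hi]
      have hridge : ∑ j : Fin m, w 0 * (u j * (b (Sum.inr j) - z j)) = -(w 0 * (u ⬝ᵥ z)) := by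
        simp [b, dotProduct, Finset.mul_sum]
      simp only [Fintype.sum_sum_type, A, Sum.elim_inl, Sum.elim_inr, single_one_dotProduct]
      rw [hridge, ← Finset.add_sum_erase _ _ (Finset.mem_univ 0), hrest]
      simp only [Function.update_self, b, Pi.single_eq_same]
      linarith
  have hzz : x 0 ⬝ᵥ (((M w)⁻¹ * (M w)⁻¹) *ᵥ x 0) = z ⬝ᵥ z := by
    rw [← mulVec_mulVec, dotProduct_mulVec, ← mulVec_transpose, transpose_nonsing_inv, hsymm]
  rw [hzz]
  refine Finset.sum_le_sum fun j _ => (le_abs_self _).trans ?_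
  have hj : |z j| ≤ C := (norm_le_pi_norm z j).trans hzC
  rw [abs_mul]
  exact mul_le_mul hj hj (abs_nonneg _) ((abs_nonneg _).trans hj)
end

section
/- There exists a finite constant K such that for every σ² = (σ_e², σ_{u₁}², …, σ_{u_r}²) ∈ (0,∞)^{r+1}, the Euclidean norm bound ‖(σ_e²)⁻¹ Q⁻¹ Zᵀ (I − P_X) y‖ ≤ K holds; that is, the function σ² ↦ ‖(σ_e²)⁻¹ Q⁻¹ Zᵀ(I−P_X)y‖ is bounded on (0,∞)^{r+1}. -/
open Matrix

open Filter Topology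

/-- The ridge solutions `b` of `(Aᵀ A + diag w) b = Aᵀ y` are bounded uniformly in the positive
weights `w`: a limit direction `u` of an unbounded family lies in the kernel of `A`, so that
`∑ k, u k * (w k * b k) = 0`, although every nonzero term of this sum is eventually positive. -/
theorem exists_norm_le_of_ridge_equation {ι κ : Type*} [Fintype ι] [Fintype κ]
    (A : Matrix ι κ ℝ) (y : ι → ℝ) :
    ∃ C : ℝ, ∀ w b : κ → ℝ, (∀ k, 0 < w k) → Aᵀ *ᵥ (A *ᵥ b) + w * b = Aᵀ *ᵥ y → ‖b‖ ≤ C := by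
  by_contra! h
  choose w b hw hb hlt using fun n : ℕ => h n
  have hpos n : 0 < ‖b n‖ := (Nat.cast_nonneg n).trans_lt (hlt n)
  have hnorm : Tendsto (fun n => ‖b n‖) atTop atTop :=
    tendsto_atTop_mono (fun n => (hlt n).le) tendsto_natCast_atTop_atTop
  obtain ⟨u, hu, φ, hφ, hlim⟩ := (isCompact_sphere (0 : κ → ℝ) 1).tendsto_subseq
    (x := fun n => ‖b n‖⁻¹ • b n) fun n => by
      simp [norm_smul, (hpos n).ne']
  have hAb n : (A *ᵥ b n) ⬝ᵥ (A *ᵥ b n) ≤ y ⬝ᵥ y := by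
    have h1 : (A *ᵥ b n) ⬝ᵥ (A *ᵥ b n) + ∑ k, w n k * b n k ^ 2 = (A *ᵥ b n) ⬝ᵥ y := by
      have := congrArg (b n ⬝ᵥ ·) (hb n)
      simp only [dotProduct_add, dotProduct_mulVec, vecMul_transpose] at this
      rw [← this, dotProduct_mulVec]
      congr 1
      exact Finset.sum_congr rfl fun k _ => by simp only [Pi.mul_apply]; ring
    have h2 : 0 ≤ ∑ k, w n k * b n k ^ 2 :=
      Finset.sum_nonneg fun k _ => mul_nonneg (hw n k).le (sq_nonneg _)
    have h3 : 0 ≤ (A *ᵥ b n - y) ⬝ᵥ (A *ᵥ b n - y) :=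
      Finset.sum_nonneg fun i _ => mul_self_nonneg _
    simp only [sub_dotProduct, dotProduct_sub, dotProduct_comm y (A *ᵥ b n)] at h3
    linarith
  have hAu : A *ᵥ u = 0 := by
    have hcont : Continuous fun v : κ → ℝ => (A *ᵥ v) ⬝ᵥ (A *ᵥ v) := by fun_prop
    have h1 := (hcont.tendsto u).comp hlim
    have h2 : Tendsto (fun n => ‖b (φ n)‖⁻¹ ^ 2 * (y ⬝ᵥ y)) atTop (𝓝 0) := by
      simpa using
        ((tendsto_inv_atTop_zero.comp (hnorm.comp hφ.tendsto_atTop)).pow 2).mul_const (y ⬝ᵥ y)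
    have h3 : (A *ᵥ u) ⬝ᵥ (A *ᵥ u) ≤ 0 := by
      refine le_of_tendsto_of_tendsto' h1 h2 fun n => ?_
      simp only [Function.comp_apply, mulVec_smul, smul_dotProduct, dotProduct_smul, smul_eq_mul]
      rw [← mul_assoc, ← sq]
      exact mul_le_mul_of_nonneg_left (hAb _) (sq_nonneg _)
    exact dotProduct_self_eq_zero.mp
      (h3.antisymm (Finset.sum_nonneg fun i _ => mul_self_nonneg _))
  have hsum n : ∑ k, u k * (w n k * b n k) = 0 := by
    have := congrArg (u ⬝ᵥ ·) (hb n)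
    simp only [dotProduct_add, dotProduct_mulVec, vecMul_transpose, hAu, zero_vecMul,
      zero_dotProduct, zero_add] at this
    exact this
  have hsign : ∀ᶠ n in atTop, ∀ k, u k ≠ 0 → 0 < u k * b (φ n) k := by
    refine eventually_all.mpr fun k => ?_
    by_cases hk : u k = 0
    · simp [hk]
    have h1 : Tendsto (fun n => u k * (‖b (φ n)‖⁻¹ * b (φ n) k)) atTop (𝓝 (u k * u k)) :=
      ((tendsto_pi_nhds.mp hlim) k).const_mul (u k)
    filter_upwards [h1.eventually_const_lt (mul_self_pos.mpr hk)] with n hn _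
    rw [mul_left_comm] at hn
    exact pos_of_mul_pos_right hn (inv_nonneg.mpr (norm_nonneg _))
  obtain ⟨n, hn⟩ := hsign.exists
  have hterm k : u k ≠ 0 → 0 < u k * (w (φ n) k * b (φ n) k) := fun hk => by
    rw [mul_left_comm]
    exact mul_pos (hw _ k) (hn k hk)
  have hu0 : u = 0 := by
    funext k
    by_contra hk
    refine (Finset.sum_pos' (fun j _ => ?_) ⟨k, Finset.mem_univ k, hterm k hk⟩).ne' (hsum (φ n))
    by_cases hj : u j = 0
    · simp [hj]
    · exact (hterm j hj).le
  simp [hu0] at hu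

/-- `X (Xᵀ X)⁻¹ Xᵀ` is idempotent; if `Xᵀ X` is singular, it is zero by convention. -/
theorem isIdempotentElem_mul_inv_mul_transpose {m n : Type*} [Fintype m] [Fintype n]
    [DecidableEq n] (X : Matrix m n ℝ) : IsIdempotentElem (X * (Xᵀ * X)⁻¹ * Xᵀ) := by
  by_cases h : IsUnit (Xᵀ * X).det
  · calc X * (Xᵀ * X)⁻¹ * Xᵀ * (X * (Xᵀ * X)⁻¹ * Xᵀ)
        = X * ((Xᵀ * X)⁻¹ * (Xᵀ * X)) * (Xᵀ * X)⁻¹ * Xᵀ := by simp only [Matrix.mul_assoc]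
      _ = X * (Xᵀ * X)⁻¹ * Xᵀ := by rw [nonsing_inv_mul _ h, Matrix.mul_one]
  · simp [IsIdempotentElem, nonsing_inv_apply_not_isUnit _ h]

/-- `X (Xᵀ X)⁻¹ Xᵀ` is symmetric. -/
theorem isSymm_mul_inv_mul_transpose {m n : Type*} [Fintype m] [Fintype n]
    [DecidableEq n] (X : Matrix m n ℝ) : (X * (Xᵀ * X)⁻¹ * Xᵀ).IsSymm := by
  simp [IsSymm, transpose_nonsing_inv, Matrix.mul_assoc]

/-- The function `σ² ↦ ‖(σ_e²)⁻¹ Q⁻¹ Zᵀ(I−P_X)y‖` is bounded on `(0,∞)^{r+1}`, where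
`Q = (σ_e²)⁻¹ Zᵀ(I−P_X)Z + D⁻¹` and `D = ⊕ᵢ σ_{uᵢ}² I_{qᵢ}`.  The Euclidean norm is
written as the square root of the sum of squares of the coordinates.
Here `σe` plays the role of `σ_e²` and `σu i` that of `σ_{uᵢ}²`. -/
theorem h_sigma_bounded_glmm
    (N p r : ℕ) (hN : 1 ≤ N) (hp : 1 ≤ p) (hr : 1 ≤ r)
    (qi : Fin r → ℕ) (hqi : ∀ i, 1 ≤ qi i)
    (y : Fin N → ℝ)
    (X : Matrix (Fin N) (Fin p) ℝ) (hX : X.rank = p)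
    (Z : Matrix (Fin N) ((i : Fin r) × Fin (qi i)) ℝ)
    (PX : Matrix (Fin N) (Fin N) ℝ) (hPX : PX = X * (Xᵀ * X)⁻¹ * Xᵀ) :
    ∃ K : ℝ, ∀ (σe : ℝ) (σu : Fin r → ℝ), 0 < σe → (∀ i, 0 < σu i) →
      Real.sqrt (∑ k,
        ((σe⁻¹ • (((σe⁻¹ • (Zᵀ * (1 - PX) * Z)
            + Matrix.diagonal fun k' => (σu k'.1)⁻¹)⁻¹ * Zᵀ * (1 - PX)) *ᵥ y)) k) ^ 2)
        ≤ K := by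
  have hsymm : (1 - PX)ᵀ = 1 - PX := by
    rw [transpose_sub, transpose_one, hPX, (isSymm_mul_inv_mul_transpose X).eq]
  have hidem : (1 - PX) * (1 - PX) = 1 - PX :=
    (hPX ▸ isIdempotentElem_mul_inv_mul_transpose X : IsIdempotentElem PX).one_sub
  set M := 1 - PX
  have hgram : (M * Z)ᵀ * (M * Z) = Zᵀ * M * Z := by
    rw [transpose_mul, hsymm, Matrix.mul_assoc, ← Matrix.mul_assoc M M Z, hidem, Matrix.mul_assoc]
  obtain ⟨C, hC⟩ := exists_norm_le_of_ridge_equation (M * Z) y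
  refine ⟨Real.sqrt (∑ _k : (i : Fin r) × Fin (qi i), C ^ 2), fun σe σu hσe hσu => ?_⟩
  set Q := σe⁻¹ • (Zᵀ * M * Z) + diagonal fun k' : (i : Fin r) × Fin (qi i) => (σu k'.1)⁻¹ with hQ
  have hQdet : IsUnit Q.det := by
    have hpsd : (Zᵀ * M * Z).PosSemidef := by
      rw [← hgram]
      simpa using posSemidef_conjTranspose_mul_self (M * Z)
    have hdiag : (diagonal fun k' : (i : Fin r) × Fin (qi i) => (σu k'.1)⁻¹).PosDef :=
      PosDef.diagonal fun k => inv_pos.mpr (hσu k.1)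
    exact (PosDef.posSemidef_add (hpsd.smul (inv_pos.mpr hσe).le) hdiag).det_pos.ne'.isUnit
  set b := σe⁻¹ • ((Q⁻¹ * Zᵀ * M) *ᵥ y) with hb
  have hQb : σe • (Q *ᵥ b) = (M * Z)ᵀ *ᵥ y := by
    rw [hb, mulVec_smul, smul_inv_smul₀ hσe.ne', mulVec_mulVec, Matrix.mul_assoc Q⁻¹,
      mul_nonsing_inv_cancel_left _ _ hQdet, transpose_mul, hsymm]
  have hbC : ‖b‖ ≤ C := by
    refine hC (fun k => σe * (σu k.1)⁻¹) b (fun k => mul_pos hσe (inv_pos.mpr (hσu k.1))) ?_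
    rw [← hQb, hQ, add_mulVec, smul_add, smul_mulVec, smul_inv_smul₀ hσe.ne', mulVec_mulVec, hgram]
    congr 1
    funext k
    simp [mulVec_diagonal, mul_assoc]
  refine Real.sqrt_le_sqrt (Finset.sum_le_sum fun k _ => ?_)
  exact sq_le_sq' (neg_le_of_abs_le ((norm_le_pi_norm b k).trans hbC))
    (le_of_abs_le ((norm_le_pi_norm b k).trans hbC))
end

section
/- Let k ≥ 1 be an integer, let μ = (μ₁,…,μ_k) ∈ ℝ^k, and let γ be a real number with 0 < γ < k/2. Let P be the product probability measure on ℝ^k whose i-th factor is the Gaussian measure with mean μ_i and variance 1. Then ∫_{ℝ^k} (x₁² + ⋯ + x_k²)^{−γ} dP(x) ≤ 2^{−γ} Γ(k/2 − γ) / Γ(k/2). -/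
open MeasureTheory ProbabilityTheory

/-- The Gamma integral as a lower Lebesgue integral. -/
lemma lintegral_rpow_mul_exp_neg_mul_Ioi {a r : ℝ} (ha : 0 < a) (hr : 0 < r) :
    ∫⁻ t in Set.Ioi (0 : ℝ), ENNReal.ofReal (t ^ (a - 1) * Real.exp (-(r * t))) =
      ENNReal.ofReal (r ^ (-a) * Real.Gamma a) := by
  have key := Real.integral_rpow_mul_exp_neg_mul_Ioi ha hr
  have hΓ := Real.Gamma_pos_of_pos ha
  rw [← ofReal_integral_eq_lintegral_ofReal (.of_integral_ne_zero (by rw [key]; positivity)),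
    key, one_div, Real.inv_rpow hr.le, Real.rpow_neg hr.le]
  filter_upwards [ae_restrict_mem measurableSet_Ioi] with t ht
  have : (0 : ℝ) < t := ht
  simp only [Pi.zero_apply]
  positivity

/-- The Laplace transform of the square of a Gaussian variable of variance `1` is largest when
the mean vanishes. -/
lemma lintegral_exp_neg_mul_sq_gaussianReal_le (m : ℝ) {t : ℝ} (ht : 0 < t) :
    ∫⁻ x, ENNReal.ofReal (Real.exp (-(t * x ^ 2))) ∂(gaussianReal m 1) ≤
      ENNReal.ofReal ((1 + 2 * t) ^ (-(1 / 2) : ℝ)) := by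
  have hb : (0 : ℝ) < 1 + 2 * t := by positivity
  let v : NNReal := ⟨(1 + 2 * t)⁻¹, (inv_pos.2 hb).le⟩
  have hvr : (v : ℝ) = (1 + 2 * t)⁻¹ := rfl
  have hv : v ≠ 0 := by
    rw [← NNReal.coe_ne_zero, hvr]
    positivity
  rw [gaussianReal_of_var_ne_zero m one_ne_zero, lintegral_withDensity_eq_lintegral_mul _
    (measurable_gaussianPDF m 1) (by fun_prop)]
  calc
    _ ≤ ∫⁻ x, ENNReal.ofReal ((1 + 2 * t) ^ (-(1 / 2) : ℝ)) *
        gaussianPDF (m / (1 + 2 * t)) v x := by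
      refine lintegral_mono fun x ↦ ?_
      simp only [Pi.mul_apply, gaussianPDF]
      rw [← ENNReal.ofReal_mul (gaussianPDFReal_nonneg _ _ _),
        ← ENNReal.ofReal_mul (by positivity)]
      refine ENNReal.ofReal_le_ofReal ?_
      have hc : (√(2 * Real.pi * (1 : NNReal)))⁻¹ =
          (1 + 2 * t) ^ (-(1 / 2) : ℝ) * (√(2 * Real.pi * v))⁻¹ := by
        rw [hvr, Real.rpow_neg hb.le, ← Real.sqrt_eq_rpow, ← mul_inv, ← Real.sqrt_mul hb.le]
        congr 2
        field_simp
        simp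
      simp only [gaussianPDFReal]
      rw [hc, mul_assoc, mul_assoc, mul_assoc, ← Real.exp_add]
      gcongr
      rw [hvr, ← sub_nonneg]
      have : -(x - m / (1 + 2 * t)) ^ 2 / (2 * (1 + 2 * t)⁻¹) -
          (-(x - m) ^ 2 / (2 * ((1 : NNReal) : ℝ)) + -(t * x ^ 2)) =
          t * m ^ 2 / (1 + 2 * t) := by
        rw [NNReal.coe_one]
        field_simp
        ring
      rw [this]
      positivity
    _ = _ := by
      rw [lintegral_const_mul _ (measurable_gaussianPDF _ _), lintegral_gaussianPDF_eq_one _ hv,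
        mul_one]

/-- Laplace transform bound for the noncentral chi-square distribution. -/
lemma lintegral_exp_neg_mul_sum_sq_pi_gaussianReal_le {k : ℕ} (μ : Fin k → ℝ) {t : ℝ}
    (ht : 0 < t) :
    ∫⁻ x : Fin k → ℝ, ENNReal.ofReal (Real.exp (-((∑ i, x i ^ 2) * t)))
        ∂(Measure.pi fun i => gaussianReal (μ i) 1) ≤
      ENNReal.ofReal ((1 + 2 * t) ^ (-((k : ℝ) / 2))) := by
  have hb : (0 : ℝ) < 1 + 2 * t := by positivity
  let g : ℝ → ENNReal := fun y ↦ ENNReal.ofReal (Real.exp (-(t * y ^ 2)))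
  have hg : Measurable g := by fun_prop
  calc
    _ = ∫⁻ x : Fin k → ℝ, ∏ i, g (x i) ∂(Measure.pi fun i => gaussianReal (μ i) 1) := by
      refine lintegral_congr fun x ↦ ?_
      rw [← ENNReal.ofReal_prod_of_nonneg fun _ _ ↦ (Real.exp_pos _).le, ← Real.exp_sum,
        Finset.sum_neg_distrib, ← Finset.mul_sum, mul_comm t]
    _ = ∏ i, ∫⁻ y, g y ∂(gaussianReal (μ i) 1) := by
      rw [lintegral_prod_eq_prod_lintegral_of_indepFun Finset.univ (fun i (x : Fin k → ℝ) ↦ g (x i))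
        (iIndepFun_pi fun _ ↦ hg.aemeasurable) fun i ↦ hg.comp (measurable_pi_apply i)]
      exact Finset.prod_congr rfl fun i _ ↦
        (measurePreserving_eval (fun i ↦ gaussianReal (μ i) 1) i).lintegral_comp hg
    _ ≤ ∏ _i : Fin k, ENNReal.ofReal ((1 + 2 * t) ^ (-(1 / 2) : ℝ)) :=
      Finset.prod_le_prod' fun i _ ↦ lintegral_exp_neg_mul_sq_gaussianReal_le (μ i) ht
    _ = _ := by
      rw [Finset.prod_const, Finset.card_univ, Fintype.card_fin,
        ← ENNReal.ofReal_pow (by positivity), ← Real.rpow_natCast, ← Real.rpow_mul hb.le]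
      congr 2
      ring

/-- A Beta integral over the half-line, evaluated through two Gamma integrals. -/
lemma Gamma_mul_lintegral_rpow_mul_one_add_two_mul_rpow {a b : ℝ} (ha : 0 < a) (hab : a < b) :
    ENNReal.ofReal (Real.Gamma b) *
        ∫⁻ t in Set.Ioi (0 : ℝ), ENNReal.ofReal (t ^ (a - 1) * (1 + 2 * t) ^ (-b)) =
      ENNReal.ofReal (2 ^ (-a) * Real.Gamma (b - a) * Real.Gamma a) := by
  have hb : 0 < b := ha.trans hab
  have hΓa := Real.Gamma_pos_of_pos ha
  have hΓb := Real.Gamma_pos_of_pos hb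
  rw [← lintegral_const_mul _ (by fun_prop)]
  calc
    _ = ∫⁻ t in Set.Ioi (0 : ℝ), ∫⁻ s in Set.Ioi (0 : ℝ), ENNReal.ofReal
        (t ^ (a - 1) * (s ^ (b - 1) * Real.exp (-((1 + 2 * t) * s)))) := by
      refine setLIntegral_congr_fun measurableSet_Ioi fun t (ht : 0 < t) ↦ ?_
      have h1 : (0 : ℝ) ≤ t ^ (a - 1) := by positivity
      simp_rw [ENNReal.ofReal_mul h1]
      rw [lintegral_const_mul _ (by fun_prop),
        lintegral_rpow_mul_exp_neg_mul_Ioi hb (by positivity), ← ENNReal.ofReal_mul h1,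
        ← ENNReal.ofReal_mul h1, ← ENNReal.ofReal_mul hΓb.le]
      congr 1
      ring
    _ = ∫⁻ s in Set.Ioi (0 : ℝ), ∫⁻ t in Set.Ioi (0 : ℝ), ENNReal.ofReal
        (t ^ (a - 1) * (s ^ (b - 1) * Real.exp (-((1 + 2 * t) * s)))) :=
      lintegral_lintegral_swap (by fun_prop)
    _ = ∫⁻ s in Set.Ioi (0 : ℝ), ENNReal.ofReal (2 ^ (-a) * Real.Gamma a) *
        ENNReal.ofReal (s ^ (b - a - 1) * Real.exp (-(1 * s))) := by
      refine setLIntegral_congr_fun measurableSet_Ioi fun s (hs : 0 < s) ↦ ?_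
      have h1 : (0 : ℝ) ≤ s ^ (b - 1) * Real.exp (-(1 * s)) := by positivity
      have h2 (t : ℝ) : t ^ (a - 1) * (s ^ (b - 1) * Real.exp (-((1 + 2 * t) * s))) =
          s ^ (b - 1) * Real.exp (-(1 * s)) * (t ^ (a - 1) * Real.exp (-(2 * s * t))) := by
        rw [show -((1 + 2 * t) * s) = -(1 * s) + -(2 * s * t) by ring, Real.exp_add]
        ring
      simp_rw [h2, ENNReal.ofReal_mul h1]
      rw [lintegral_const_mul _ (by fun_prop),
        lintegral_rpow_mul_exp_neg_mul_Ioi ha (by positivity), ← ENNReal.ofReal_mul h1,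
        ← ENNReal.ofReal_mul (by positivity), Real.mul_rpow two_pos.le hs.le,
        show b - a - 1 = (b - 1) + -a by ring, Real.rpow_add hs]
      congr 1
      ring
    _ = _ := by
      rw [lintegral_const_mul _ (by fun_prop),
        lintegral_rpow_mul_exp_neg_mul_Ioi (sub_pos.2 hab) one_pos,
        ← ENNReal.ofReal_mul (by positivity), Real.one_rpow]
      congr 1
      ring

/-- Negative moment bound for the noncentral chi-square distribution: if
`x = (x₁,…,x_k)` has independent `N(μᵢ, 1)` coordinates and `0 < γ < k/2`, then
`E[(x₁² + ⋯ + x_k²)^(−γ)] ≤ 2^(−γ) Γ(k/2 − γ)/Γ(k/2)`. -/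
theorem noncentral_chisq_neg_moment_bound (k : ℕ) (hk : 1 ≤ k) (μ : Fin k → ℝ)
    (γ : ℝ) (hγ0 : 0 < γ) (hγ : γ < (k : ℝ) / 2) :
    ∫⁻ x : Fin k → ℝ, ENNReal.ofReal ((∑ i, x i ^ 2) ^ (-γ))
        ∂(Measure.pi fun i => gaussianReal (μ i) 1)
      ≤ ENNReal.ofReal ((2 : ℝ) ^ (-γ) * Real.Gamma ((k : ℝ) / 2 - γ)
          / Real.Gamma ((k : ℝ) / 2)) := by
  have hk2 : (0 : ℝ) < k / 2 := hγ0.trans hγ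
  have hΓγ := Real.Gamma_pos_of_pos hγ0
  have hΓk := Real.Gamma_pos_of_pos hk2
  set P := Measure.pi fun i => gaussianReal (μ i) 1
  have hbound : (∫⁻ x : Fin k → ℝ, ENNReal.ofReal ((∑ i, x i ^ 2) ^ (-γ)) ∂P) *
      ENNReal.ofReal (Real.Gamma γ) ≤
        ∫⁻ t in Set.Ioi (0 : ℝ), ENNReal.ofReal (t ^ (γ - 1) * (1 + 2 * t) ^ (-((k : ℝ) / 2))) := by
    rw [← lintegral_mul_const _ (by fun_prop)]
    calc
      _ ≤ ∫⁻ x : Fin k → ℝ, (∫⁻ t in Set.Ioi (0 : ℝ), ENNReal.ofReal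
          (t ^ (γ - 1) * Real.exp (-((∑ i, x i ^ 2) * t)))) ∂P := by
        refine lintegral_mono fun x ↦ ?_
        have hq : 0 ≤ ∑ i, x i ^ 2 := Finset.sum_nonneg fun i _ ↦ sq_nonneg (x i)
        rcases hq.eq_or_lt with h0 | hpos
        · simp [← h0, Real.zero_rpow (neg_ne_zero.2 hγ0.ne')]
        · rw [lintegral_rpow_mul_exp_neg_mul_Ioi hγ0 hpos, ENNReal.ofReal_mul (by positivity)]
      _ = ∫⁻ t in Set.Ioi (0 : ℝ), ∫⁻ x : Fin k → ℝ, ENNReal.ofReal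
          (t ^ (γ - 1) * Real.exp (-((∑ i, x i ^ 2) * t))) ∂P :=
        lintegral_lintegral_swap (by fun_prop)
      _ ≤ _ := by
        refine setLIntegral_mono (by fun_prop) fun t (ht : 0 < t) ↦ ?_
        have h1 : (0 : ℝ) ≤ t ^ (γ - 1) := by positivity
        simp_rw [ENNReal.ofReal_mul h1]
        rw [lintegral_const_mul _ (by fun_prop)]
        gcongr
        exact lintegral_exp_neg_mul_sum_sq_pi_gaussianReal_le μ ht
  rw [ENNReal.ofReal_div_of_pos hΓk, ENNReal.le_div_iff_mul_le (by simp [hΓk]) (by simp),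
    ← ENNReal.mul_le_mul_iff_left (c := ENNReal.ofReal (Real.Gamma γ)) (by simp [hΓγ]) (by simp)]
  calc
    _ = ENNReal.ofReal (Real.Gamma ((k : ℝ) / 2)) *
        ((∫⁻ x : Fin k → ℝ, ENNReal.ofReal ((∑ i, x i ^ 2) ^ (-γ)) ∂P) *
          ENNReal.ofReal (Real.Gamma γ)) := by ring
    _ ≤ ENNReal.ofReal (Real.Gamma ((k : ℝ) / 2)) * ∫⁻ t in Set.Ioi (0 : ℝ),
        ENNReal.ofReal (t ^ (γ - 1) * (1 + 2 * t) ^ (-((k : ℝ) / 2))) := by gcongr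
    _ = _ := by
      rw [Gamma_mul_lintegral_rpow_mul_one_add_two_mul_rpow hγ0 hγ, ENNReal.ofReal_mul]
      have := Real.Gamma_pos_of_pos (sub_pos.2 hγ)
      positivity
end

section
/- Let z, x₁, x₂ be real numbers with 0 < z < x₁ < x₂. Then Γ(x₁ − z)/Γ(x₁) > Γ(x₂ − z)/Γ(x₂); that is, the function x ↦ Γ(x − z)/Γ(x) is strictly decreasing on (z, ∞). -/
/-- Moving two points of an interval towards each other by the same amount does not increase
the sum of the values of a convex function. -/
theorem ConvexOn.map_add_add_map_le {s : Set ℝ} {f : ℝ → ℝ} (hf : ConvexOn ℝ s f) {a h k : ℝ}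
    (hh : 0 < h) (hk : 0 < k) (ha : a ∈ s) (hb : a + h + k ∈ s) :
    f (a + h) + f (a + k) ≤ f a + f (a + h + k) := by
  have hhk : h + k ≠ 0 := (add_pos hh hk).ne'
  have hsum : k / (h + k) + h / (h + k) = 1 := by field_simp; ring
  have e₁ := hf.2 ha hb (by positivity : 0 ≤ k / (h + k)) (by positivity : 0 ≤ h / (h + k)) hsum
  have e₂ := hf.2 ha hb (by positivity : 0 ≤ h / (h + k)) (by positivity : 0 ≤ k / (h + k))
    (by rw [add_comm, hsum])
  simp only [smul_eq_mul] at e₁ e₂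
  rw [show k / (h + k) * a + h / (h + k) * (a + h + k) = a + h by field_simp; ring] at e₁
  rw [show h / (h + k) * a + k / (h + k) * (a + h + k) = a + k by field_simp; ring] at e₂
  linear_combination e₁ + e₂ + (f a + f (a + h + k)) * hsum

/-- Multiplicative form of the log-convexity of the Gamma function. -/
theorem Real.Gamma_add_mul_Gamma_add_le {a h k : ℝ} (ha : 0 < a) (hh : 0 < h) (hk : 0 < k) :
    Real.Gamma (a + h) * Real.Gamma (a + k) ≤ Real.Gamma a * Real.Gamma (a + h + k) := by
  have g₀ := Real.Gamma_pos_of_pos ha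
  have g₁ := Real.Gamma_pos_of_pos (add_pos ha hh)
  have g₂ := Real.Gamma_pos_of_pos (add_pos ha hk)
  have g₃ := Real.Gamma_pos_of_pos (add_pos (add_pos ha hh) hk)
  rw [← Real.log_le_log_iff (by positivity) (by positivity), Real.log_mul g₁.ne' g₂.ne',
    Real.log_mul g₀.ne' g₃.ne']
  exact Real.convexOn_log_Gamma.map_add_add_map_le hh hk ha (add_pos (add_pos ha hh) hk)

/-- Strict form, obtained from the weak one at `a + 1` through the functional equation. -/
theorem Real.Gamma_add_mul_Gamma_add_lt {a h k : ℝ} (ha : 0 < a) (hh : 0 < h) (hk : 0 < k) :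
    Real.Gamma (a + h) * Real.Gamma (a + k) < Real.Gamma a * Real.Gamma (a + h + k) := by
  have g₁ := Real.Gamma_pos_of_pos (add_pos ha hh)
  have g₂ := Real.Gamma_pos_of_pos (add_pos ha hk)
  have key := Real.Gamma_add_mul_Gamma_add_le (add_pos ha one_pos) hh hk
  rw [show a + 1 + h = a + h + 1 by ring, show a + 1 + k = a + k + 1 by ring,
    show a + h + 1 + k = a + h + k + 1 by ring, Real.Gamma_add_one (by positivity),
    Real.Gamma_add_one (by positivity), Real.Gamma_add_one (by positivity),
    Real.Gamma_add_one (by positivity)] at key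
  have hc : 0 < a * (a + h + k) := by positivity
  refine lt_of_mul_lt_mul_left ?_ hc.le
  have : 0 < h * k * (Real.Gamma (a + h) * Real.Gamma (a + k)) := by positivity
  linear_combination key + this

/-- The function `x ↦ Γ(x - z)/Γ(x)` is strictly decreasing on `(z, ∞)` for `z > 0`:
if `0 < z < x₁ < x₂`, then `Γ(x₁ - z)/Γ(x₁) > Γ(x₂ - z)/Γ(x₂)`. -/
theorem gamma_ratio_strict_anti (z x₁ x₂ : ℝ) (hz : 0 < z) (h₁ : z < x₁) (h₂ : x₁ < x₂) :
    Real.Gamma (x₂ - z) / Real.Gamma x₂ < Real.Gamma (x₁ - z) / Real.Gamma x₁ := by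
  have hx₁ : 0 < x₁ := hz.trans h₁
  rw [div_lt_div_iff₀ (Real.Gamma_pos_of_pos (hx₁.trans h₂)) (Real.Gamma_pos_of_pos hx₁)]
  have key := Real.Gamma_add_mul_Gamma_add_lt (sub_pos.2 h₁) (sub_pos.2 h₂) hz
  rwa [show x₁ - z + (x₂ - x₁) = x₂ - z by ring, sub_add_cancel, sub_add_cancel] at key
end

section
/- Let a_e, a₁, …, a_r be real numbers, set t = rank(Zᵀ(I−P_X)Z), M = Zᵀ(I−P_X)Z, and s̃ = min{ q₁+2a₁, …, q_r+2a_r, N+2a_e }. Suppose there exists s ∈ (0,1] with s < s̃/2 such that both 2^{−s} (p+t)^s Γ(N/2+a_e−s)/Γ(N/2+a_e) < 1 and 2^{−s} Σ_{i=1}^r [Γ(q_i/2+a_i−s)/Γ(q_i/2+a_i)] · ( tr(R_i (I_q − P_M) R_iᵀ) )^s < 1. Then N + 2a_e > p + t, and q_i + 2a_i > tr(R_i (I_q − P_M) R_iᵀ) for each i ∈ {1,…,r}. -/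
open Matrix

/-- Wendel-type upper bound for a ratio of Gamma functions. -/
theorem Real.Gamma_add_le_rpow_mul_Gamma {x s : ℝ} (hx : 0 < x) (hs : 0 < s) (hs1 : s ≤ 1) :
    Real.Gamma (x + s) ≤ x ^ s * Real.Gamma x := by
  have hG := Real.Gamma_pos_of_pos hx
  rcases hs1.lt_or_eq with h | rfl
  · have key := Real.Gamma_mul_add_mul_le_rpow_Gamma_mul_rpow_Gamma hx
      (by linarith : 0 < x + 1) (sub_pos.2 h) hs (by ring)
    have e : (1 - s) * x + s * (x + 1) = x + s := by ring
    rw [e, Real.Gamma_add_one hx.ne', Real.mul_rpow hx.le hG.le] at key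
    calc Real.Gamma (x + s)
        ≤ Real.Gamma x ^ (1 - s) * (x ^ s * Real.Gamma x ^ s) := key
      _ = x ^ s * (Real.Gamma x ^ (1 - s) * Real.Gamma x ^ s) := by ring
      _ = x ^ s * Real.Gamma x := by
        rw [← Real.rpow_add hG, sub_add_cancel, Real.rpow_one]
  · rw [Real.Gamma_add_one hx.ne', Real.rpow_one]

theorem lt_two_mul_of_rpow_mul_Gamma_ratio_lt_one {c y s : ℝ} (hc : 0 ≤ c) (hs : 0 < s)
    (hs1 : s ≤ 1) (hy : s < y)
    (h : (2 : ℝ) ^ (-s) * (Real.Gamma (y - s) / Real.Gamma y * c ^ s) < 1) : c < 2 * y := by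
  have hy0 : 0 < y := hs.trans hy
  have hx : 0 < y - s := sub_pos.2 hy
  have hGx := Real.Gamma_pos_of_pos hx
  have hGy := Real.Gamma_pos_of_pos hy0
  have hb := Real.Gamma_add_le_rpow_mul_Gamma hx hs hs1
  rw [sub_add_cancel] at hb
  have h2 : (0 : ℝ) < 2 ^ s := by positivity
  have h' : Real.Gamma (y - s) * c ^ s < 2 ^ s * Real.Gamma y := by
    have e : (2 : ℝ) ^ (-s) * (Real.Gamma (y - s) / Real.Gamma y * c ^ s) =
        Real.Gamma (y - s) * c ^ s / (2 ^ s * Real.Gamma y) := by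
      rw [Real.rpow_neg zero_le_two]
      field_simp
    rwa [e, div_lt_one (by positivity)] at h
  have hmono : (y - s) ^ s ≤ y ^ s := Real.rpow_le_rpow hx.le (by linarith) hs.le
  rw [← Real.rpow_lt_rpow_iff hc (by positivity) hs, Real.mul_rpow zero_le_two hy0.le]
  refine lt_of_mul_lt_mul_left (h'.trans_le ?_) hGx.le
  calc (2 : ℝ) ^ s * Real.Gamma y ≤ 2 ^ s * ((y - s) ^ s * Real.Gamma (y - s)) := by gcongr
    _ ≤ 2 ^ s * (y ^ s * Real.Gamma (y - s)) := by gcongr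
    _ = Real.Gamma (y - s) * (2 ^ s * y ^ s) := by ring

theorem Matrix.trace_mul_one_sub_mul_transpose_nonneg {m n : Type*} [Fintype m] [Fintype n]
    [DecidableEq n] {P : Matrix n n ℝ} (hP : P.IsHermitian) (hPP : P * P = P)
    (R : Matrix m n ℝ) : 0 ≤ (R * (1 - P) * Rᵀ).trace := by
  have hT : Pᵀ = P := by simpa [Matrix.IsHermitian, conjTranspose_eq_transpose_of_trivial] using hP
  have e : R * (1 - P) * Rᵀ = (R * (1 - P)) * (R * (1 - P))ᵀ := by
    have hid : (1 - P) * (1 - P) = 1 - P := by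
      rw [mul_sub, sub_mul, sub_mul, hPP]
      simp
    rw [transpose_mul, transpose_sub, transpose_one, hT, Matrix.mul_assoc R (1 - P) (_ * _),
      ← Matrix.mul_assoc (1 - P), hid, Matrix.mul_assoc]
  rw [e, ← conjTranspose_eq_transpose_of_trivial]
  exact (posSemidef_self_mul_conjTranspose _).trace_nonneg

/-- If there exists `s ∈ (0,1]` with `s < s̃/2`
(`s̃ = min{q₁+2a₁,…,q_r+2a_r, N+2a_e}`) satisfying the two inequalities
`2^{−s}(p+t)^s Γ(N/2+a_e−s)/Γ(N/2+a_e) < 1` and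
`2^{−s} Σᵢ [Γ(qᵢ/2+aᵢ−s)/Γ(qᵢ/2+aᵢ)]·(tr(Rᵢ(I−P_M)Rᵢᵀ))^s < 1`,
then `N + 2a_e > p + t` and `qᵢ + 2aᵢ > tr(Rᵢ(I−P_M)Rᵢᵀ)` for each `i`. -/
theorem main_conditions_necessary_bounds
    (N p q r : ℕ) (hN : 1 ≤ N) (hp : 1 ≤ p) (hr : 1 ≤ r)
    (qi : Fin r → ℕ) (hqi : ∀ i, 1 ≤ qi i) (hq : ∑ i, qi i = q)
    (X : Matrix (Fin N) (Fin p) ℝ) (hX : X.rank = p)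
    (Z : Matrix (Fin N) ((i : Fin r) × Fin (qi i)) ℝ)
    (PX : Matrix (Fin N) (Fin N) ℝ) (hPX : PX = X * (Xᵀ * X)⁻¹ * Xᵀ)
    (M : Matrix ((i : Fin r) × Fin (qi i)) ((i : Fin r) × Fin (qi i)) ℝ)
    (hM : M = Zᵀ * (1 - PX) * Z)
    (PM : Matrix ((i : Fin r) × Fin (qi i)) ((i : Fin r) × Fin (qi i)) ℝ)
    (hPM1 : PM.IsHermitian) (hPM2 : PM * PM = PM)
    (hPM3 : LinearMap.range PM.mulVecLin = LinearMap.range M.mulVecLin)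
    (R : (i : Fin r) → Matrix (Fin (qi i)) ((j : Fin r) × Fin (qi j)) ℝ)
    (hR : ∀ i j k, R i j k = if k = ⟨i, j⟩ then 1 else 0)
    (ae : ℝ) (a : Fin r → ℝ) (t : ℕ) (ht : t = M.rank)
    (hs : ∃ s : ℝ, 0 < s ∧ s ≤ 1 ∧ (∀ i, s < ((qi i : ℝ) + 2 * a i) / 2) ∧
        s < ((N : ℝ) + 2 * ae) / 2 ∧
        (2 : ℝ) ^ (-s) * ((p : ℝ) + (t : ℝ)) ^ s *
          (Real.Gamma ((N : ℝ) / 2 + ae - s) / Real.Gamma ((N : ℝ) / 2 + ae)) < 1 ∧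
        (2 : ℝ) ^ (-s) * ∑ i,
          (Real.Gamma ((qi i : ℝ) / 2 + a i - s) / Real.Gamma ((qi i : ℝ) / 2 + a i)) *
            ((R i * (1 - PM) * (R i)ᵀ).trace) ^ s < 1) :
    (N : ℝ) + 2 * ae > (p : ℝ) + (t : ℝ) ∧
    ∀ i, (qi i : ℝ) + 2 * a i > (R i * (1 - PM) * (R i)ᵀ).trace := by
  obtain ⟨s, hs0, hs1, hsi, hse, h1, h2⟩ := hs
  have htr : ∀ i, 0 ≤ (R i * (1 - PM) * (R i)ᵀ).trace := fun i =>
    trace_mul_one_sub_mul_transpose_nonneg hPM1 hPM2 (R i)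
  refine ⟨?_, fun i => ?_⟩
  · have := lt_two_mul_of_rpow_mul_Gamma_ratio_lt_one (c := (p : ℝ) + t)
      (y := (N : ℝ) / 2 + ae) (by positivity) hs0 hs1 (by linarith)
      (lt_of_eq_of_lt (by ring) h1)
    linarith
  · have hterm := Finset.single_le_sum (s := Finset.univ)
      (f := fun i => Real.Gamma ((qi i : ℝ) / 2 + a i - s) / Real.Gamma ((qi i : ℝ) / 2 + a i) *
        ((R i * (1 - PM) * (R i)ᵀ).trace) ^ s)
      (fun j _ => mul_nonneg
        (div_nonneg (Real.Gamma_nonneg_of_nonneg (by linarith [hsi j]))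
          (Real.Gamma_nonneg_of_nonneg (by linarith [hsi j])))
        (Real.rpow_nonneg (htr j) s)) (Finset.mem_univ i)
    have := lt_two_mul_of_rpow_mul_Gamma_ratio_lt_one (htr i) hs0 hs1
      (y := (qi i : ℝ) / 2 + a i) (by linarith [hsi i])
      ((mul_le_mul_of_nonneg_left hterm (by positivity)).trans_lt h2)
    linarith
end

section
/- Assume rank(X) = p. Then for every σ² = (σ_e², σ_{u₁}², …, σ_{u_r}²) ∈ (0,∞)^{r+1}, the function (β, u) ↦ exp( −‖y − Xβ − Zu‖² / (2σ_e²) ) · exp( −uᵀ D⁻¹ u / 2 ) is Lebesgue-integrable over ℝ^p × ℝ^q. -/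
open Matrix MeasureTheory

/-- The radial Gaussian `exp (-b ‖x‖²)` is integrable for every norm on a nontrivial
finite-dimensional real space. -/
lemma integrable_exp_neg_mul_norm_sq {E : Type*} [NormedAddCommGroup E] [NormedSpace ℝ E]
    [FiniteDimensional ℝ E] [Nontrivial E] [MeasurableSpace E] [BorelSpace E]
    (μ : Measure E) [μ.IsAddHaarMeasure] {b : ℝ} (hb : 0 < b) :
    Integrable (fun x : E => Real.exp (-b * ‖x‖ ^ 2)) μ := by
  refine (integrable_fun_norm_addHaar μ (f := fun t : ℝ => Real.exp (-b * t ^ 2))).2 ?_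
  have hs : (-1 : ℝ) < (Module.finrank ℝ E - 1 : ℕ) :=
    neg_one_lt_zero.trans_le (Nat.cast_nonneg _)
  simpa only [Real.rpow_natCast, smul_eq_mul] using integrableOn_rpow_mul_exp_neg_mul_sq hb hs

/-- The Gaussian `exp (-b ‖L x - v‖²)` is integrable when `L` is linear and injective. -/
lemma integrable_exp_neg_mul_norm_linearMap_sub_sq {E F : Type*}
    [NormedAddCommGroup E] [NormedSpace ℝ E] [FiniteDimensional ℝ E] [Nontrivial E]
    [MeasurableSpace E] [BorelSpace E] [NormedAddCommGroup F] [NormedSpace ℝ F]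
    (μ : Measure E) [μ.IsAddHaarMeasure] {L : E →ₗ[ℝ] F} (hL : Function.Injective L) (v : F)
    {b : ℝ} (hb : 0 < b) :
    Integrable (fun x : E => Real.exp (-b * ‖L x - v‖ ^ 2)) μ := by
  obtain ⟨K, hK, hLK⟩ := L.injective_iff_antilipschitz.1 hL
  have hK' : (0 : ℝ) < K := hK
  have hc : 0 < b / (2 * (K : ℝ) ^ 2) := by positivity
  refine ((integrable_exp_neg_mul_norm_sq μ hc).const_mul (Real.exp (b * ‖v‖ ^ 2))).mono' ?_ ?_
  · have hcont : Continuous L := L.continuous_of_finiteDimensional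
    exact (by fun_prop : Continuous fun x : E =>
      Real.exp (-b * ‖L x - v‖ ^ 2)).aestronglyMeasurable
  · refine ae_of_all _ fun x => ?_
    rw [Real.norm_eq_abs, Real.abs_exp, ← Real.exp_add, Real.exp_le_exp]
    have hx : ‖x‖ ≤ K * (‖L x - v‖ + ‖v‖) :=
      (ZeroHomClass.bound_of_antilipschitz L hLK x).trans <|
        mul_le_mul_of_nonneg_left (norm_le_norm_sub_add _ _) hK'.le
    have hsq : ‖x‖ ^ 2 ≤ 2 * (K : ℝ) ^ 2 * (‖L x - v‖ ^ 2 + ‖v‖ ^ 2) := by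
      calc ‖x‖ ^ 2 ≤ (K * (‖L x - v‖ + ‖v‖)) ^ 2 := by gcongr
        _ = (K : ℝ) ^ 2 * (‖L x - v‖ + ‖v‖) ^ 2 := mul_pow _ _ _
        _ ≤ (K : ℝ) ^ 2 * (2 * (‖L x - v‖ ^ 2 + ‖v‖ ^ 2)) := by
          gcongr
          exact add_sq_le
        _ = 2 * (K : ℝ) ^ 2 * (‖L x - v‖ ^ 2 + ‖v‖ ^ 2) := by ring
    have hdiv : b / (2 * (K : ℝ) ^ 2) * ‖x‖ ^ 2 ≤ b * (‖L x - v‖ ^ 2 + ‖v‖ ^ 2) := by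
      rw [div_mul_eq_mul_div, div_le_iff₀ (by positivity)]
      nlinarith [mul_le_mul_of_nonneg_left hsq hb.le]
    linarith

/-- The squared sup norm on a finite product is at most the sum of squares. -/
lemma pi_norm_sq_le_sum_sq {ι : Type*} [Fintype ι] (x : ι → ℝ) : ‖x‖ ^ 2 ≤ ∑ i, x i ^ 2 := by
  have h : ‖x‖ ≤ √(∑ i, x i ^ 2) :=
    (pi_norm_le_iff_of_nonneg (Real.sqrt_nonneg _)).2 fun i =>
      Real.abs_le_sqrt (Finset.single_le_sum (fun j _ => sq_nonneg (x j)) (Finset.mem_univ i))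
  exact (Real.le_sqrt (norm_nonneg x) (Finset.sum_nonneg fun i _ => sq_nonneg (x i))).1 h

/-- A matrix whose rank is its number of columns acts injectively. -/
lemma mulVec_injective_of_rank_eq_card {m n K : Type*} [Fintype n] [Field K]
    {A : Matrix m n K} (hA : A.rank = Fintype.card n) : Function.Injective A.mulVec := by
  have h := A.mulVecLin.finrank_range_add_finrank_ker
  rw [Module.finrank_fintype_fun_eq_card, ← hA] at h
  have hker : Module.finrank K A.mulVecLin.ker = 0 := by
    unfold Matrix.rank at h
    omega
  exact LinearMap.ker_eq_bot.1 (Submodule.finrank_eq_zero.1 hker)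

/-- If `rank(X) = p`, then for every `σ² ∈ (0,∞)^{r+1}` the function
`(β, u) ↦ exp(−‖y − Xβ − Zu‖²/(2σ_e²)) · exp(−uᵀD⁻¹u/2)` is Lebesgue-integrable over
`ℝ^p × ℝ^q`, where `D = ⊕ᵢ σ_{uᵢ}² I_{qᵢ}` so that `uᵀD⁻¹u = Σ_k u_k²/σ_{u,k}²`.
Here `σe` plays the role of `σ_e²` and `σu i` that of `σ_{uᵢ}²`. -/
theorem integrable_theta_glmm
    (N p r : ℕ) (hN : 1 ≤ N) (hp : 1 ≤ p) (hr : 1 ≤ r)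
    (qi : Fin r → ℕ) (hqi : ∀ i, 1 ≤ qi i)
    (y : Fin N → ℝ)
    (X : Matrix (Fin N) (Fin p) ℝ) (hX : X.rank = p)
    (Z : Matrix (Fin N) ((i : Fin r) × Fin (qi i)) ℝ)
    (σe : ℝ) (hσe : 0 < σe) (σu : Fin r → ℝ) (hσu : ∀ i, 0 < σu i) :
    Integrable (fun θ : (Fin p → ℝ) × (((i : Fin r) × Fin (qi i)) → ℝ) =>
      Real.exp (-(∑ nn, (y nn - (X *ᵥ θ.1) nn - (Z *ᵥ θ.2) nn) ^ 2) / (2 * σe)) *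
      Real.exp (-(∑ k, θ.2 k ^ 2 / σu k.1) / 2)) := by
  have : Nonempty (Fin p) := ⟨⟨0, hp⟩⟩
  have hXinj : Function.Injective X.mulVec :=
    mulVec_injective_of_rank_eq_card (by rw [hX, Fintype.card_fin])
  -- Standardizing the residual and the random effects turns the exponent into a sum of squares.
  let L : (Fin p → ℝ) × (((i : Fin r) × Fin (qi i)) → ℝ) →ₗ[ℝ]
      (Fin N → ℝ) × (((i : Fin r) × Fin (qi i)) → ℝ) :=
    { toFun := fun θ => ((√σe)⁻¹ • (X *ᵥ θ.1 + Z *ᵥ θ.2), fun k => (√(σu k.1))⁻¹ * θ.2 k)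
      map_add' := fun θ η => by
        ext k
        · simp [mulVec_add]
          ring
        · simp [mul_add]
      map_smul' := fun c θ => by
        ext k
        · simp [mulVec_smul]
          ring
        · simp
          ring }
  have hL : Function.Injective L := by
    rintro ⟨β, u⟩ ⟨β', u'⟩ h
    have h₁ : (√σe)⁻¹ • (X *ᵥ β + Z *ᵥ u) = (√σe)⁻¹ • (X *ᵥ β' + Z *ᵥ u') :=
      congrArg Prod.fst h
    have h₂ : (fun k : (i : Fin r) × Fin (qi i) => (√(σu k.1))⁻¹ * u k) =
        fun k => (√(σu k.1))⁻¹ * u' k := congrArg Prod.snd h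
    have hu : u = u' := funext fun k =>
      mul_left_cancel₀ (inv_ne_zero (Real.sqrt_pos.2 (hσu k.1)).ne') (congrFun h₂ k)
    subst hu
    have h₃ := smul_right_injective _ (inv_ne_zero (Real.sqrt_pos.2 hσe).ne') h₁
    rw [hXinj (add_right_cancel h₃)]
  have : ((volume : Measure (Fin p → ℝ)).prod
    (volume : Measure (((i : Fin r) × Fin (qi i)) → ℝ))).IsAddHaarMeasure :=
    Measure.prod.instIsAddHaarMeasure _ _
  refine (integrable_exp_neg_mul_norm_linearMap_sub_sq
    (volume.prod volume) hL ((√σe)⁻¹ • y, 0)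
    (one_half_pos (α := ℝ))).mono' ?_ ?_
  · exact Continuous.aestronglyMeasurable (by fun_prop)
  · refine ae_of_all _ fun θ => ?_
    rw [← Real.exp_add, Real.norm_eq_abs, Real.abs_exp, Real.exp_le_exp]
    set w := L θ - ((√σe)⁻¹ • y, 0)
    have hw₁ : ∑ n, w.1 n ^ 2 =
        (∑ n, (y n - (X *ᵥ θ.1) n - (Z *ᵥ θ.2) n) ^ 2) / σe := by
      rw [Finset.sum_div]
      refine Finset.sum_congr rfl fun n _ => ?_
      have : w.1 n = (√σe)⁻¹ * ((X *ᵥ θ.1) n + (Z *ᵥ θ.2) n) - (√σe)⁻¹ * y n := rfl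
      rw [this, ← mul_sub, mul_pow, inv_pow, Real.sq_sqrt hσe.le]
      ring
    have hw₂ : ∑ k, w.2 k ^ 2 = ∑ k, θ.2 k ^ 2 / σu k.1 := by
      refine Finset.sum_congr rfl fun k _ => ?_
      have : w.2 k = (√(σu k.1))⁻¹ * θ.2 k - 0 := rfl
      rw [this, sub_zero, mul_pow, inv_pow, Real.sq_sqrt (hσu k.1).le]
      ring
    have hnorm : ‖w‖ ^ 2 ≤ ∑ n, w.1 n ^ 2 + ∑ k, w.2 k ^ 2 := by
      have h₁ := pi_norm_sq_le_sum_sq w.1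
      have h₂ := pi_norm_sq_le_sum_sq w.2
      rcases max_choice ‖w.1‖ ‖w.2‖ with h | h <;> rw [Prod.norm_def, h] <;>
        nlinarith [sq_nonneg ‖w.1‖, sq_nonneg ‖w.2‖]
    rw [hw₁, hw₂] at hnorm
    rw [neg_div, mul_comm 2 σe, ← div_div]
    linarith
end
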